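/- arXiv:2308.05175 — 8 statements merged into one kernel-verified Lean document; each statement's English description precedes it below -/
import Mathlib

section
/- Let n ≥ 4 and let K̃_n be the graph obtained from the complete bipartite graph K_{n,n} by deleting all 'diagonal' edges jj', j ∈ [n]. Then every 1-cycle in K̃_n is the sum (symmetric difference) of the edge sets of finitely many simple cycles of length 4 of K̃_n. -/
open scoped Classical

/-- A 1-cycle (modulo 2) in a graph `G`: a set `C` of edges of `G` such that
every vertex is contained in an even number of edges from `C`. -/
def IsOneCycle {V : Type*} [Fintype V] (G : SimpleGraph V) (C : Finset (Sym2 V)) : Prop :=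
  (∀ e ∈ C, e ∈ G.edgeSet) ∧ ∀ v : V, Even ((C.filter (fun e => v ∈ e)).card)

/-- The graph `K̃_n`: the complete bipartite graph `K_{n,n}` with all
"diagonal" edges `jj'` deleted. -/
def Ktilde (n : ℕ) : SimpleGraph (Fin n ⊕ Fin n) :=
  (completeBipartiteGraph (Fin n) (Fin n)).deleteEdges
    {e | ∃ j : Fin n, e = s(Sum.inl j, Sum.inr j)}

/-- A function on the off-diagonal pairs of a type with at least four elements that sums to zero
over every off-diagonal rectangle splits as a sum of functions of the single coordinates. -/
theorem exists_eq_add_of_rectangle_sum_eq_zero {α : Type*} [Fintype α]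
    (hα : 4 ≤ Fintype.card α) (g : α → α → ZMod 2)
    (hg : ∀ a b c d, a ≠ b → c ≠ d → a ≠ c → a ≠ d → b ≠ c → b ≠ d →
      g a c + g b c + g b d + g a d = 0) :
    ∃ u v : α → ZMod 2, ∀ i j, i ≠ j → g i j = u i + v j := by
  have avoid : ∀ a b c : α, ∃ d, a ≠ d ∧ b ≠ d ∧ c ≠ d := by
    intro a b c
    obtain ⟨d, hd⟩ : ∃ d, d ∉ ({a, b, c} : Finset α) := by
      by_contra! h
      have hle : Fintype.card α ≤ 3 :=
        (Finset.card_le_card fun x _ => h x).trans Finset.card_le_three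
      omega
    simp only [Finset.mem_insert, Finset.mem_singleton, not_or] at hd
    exact ⟨d, Ne.symm hd.1, Ne.symm hd.2.1, Ne.symm hd.2.2⟩
  have indep : ∀ a b c d, a ≠ c → a ≠ d → b ≠ c → b ≠ d →
      g a c + g b c = g a d + g b d := by
    intro a b c d hac had hbc hbd
    by_cases hab : a = b
    · subst hab
      simp [CharTwo.add_self_eq_zero]
    by_cases hcd : c = d
    · rw [hcd]
    rw [← CharTwo.add_eq_zero, ← hg a b c d hab hcd hac had hbc hbd]
    ring
  obtain ⟨z⟩ : Nonempty α := Fintype.card_pos_iff.mp (by omega)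
  choose t hzt hat _ using fun a => avoid z a a
  choose s hs _ _ using fun j => avoid j j j
  refine ⟨fun a => g z (t a) + g a (t a),
    fun j => g (s j) j + (g z (t (s j)) + g (s j) (t (s j))), fun i j hij => ?_⟩
  obtain ⟨d, hzd, hid, hkd⟩ := avoid z i (s j)
  have hi := indep z i (t i) d (hzt i) hzd (hat i) hid
  have hk := indep z (s j) (t (s j)) d (hzt _) hzd (hat _) hkd
  have hik := indep i (s j) j d hij hid (hs j).symm hkd
  dsimp only
  rw [hi, hk]
  have h2 : (2 : ZMod 2) = 0 := rfl
  linear_combination hik - (g z d + g (s j) j) * h2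

/-- In a 1-cycle, summing a vertex weight over the endpoints of all edges gives zero modulo 2. -/
theorem IsOneCycle.sum_endpoint_weights_eq_zero {V : Type*} [Fintype V] [DecidableEq V]
    {G : SimpleGraph V} {C : Finset (Sym2 V)} (hC : IsOneCycle G C) (w : V → ZMod 2) :
    ∑ e ∈ C, ∑ v with v ∈ e, w v = 0 := by
  simp_rw [Finset.sum_filter]
  rw [Finset.sum_comm]
  refine Finset.sum_eq_zero fun v _ => ?_
  have heven : Even (C.filter fun e => v ∈ e).card := by
    convert hC.2 v
  rw [← Finset.sum_filter, Finset.sum_const, nsmul_eq_mul, heven.natCast_zmod_two, zero_mul]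

theorem ktilde_adj_inl_inr {n : ℕ} {i j : Fin n} :
    (Ktilde n).Adj (Sum.inl i) (Sum.inr j) ↔ i ≠ j := by
  simp [Ktilde, SimpleGraph.deleteEdges_adj]
  grind

theorem exists_eq_of_mem_edgeSet_ktilde {n : ℕ} {e : Sym2 (Fin n ⊕ Fin n)}
    (he : e ∈ (Ktilde n).edgeSet) : ∃ i j, i ≠ j ∧ e = s(Sum.inl i, Sum.inr j) := by
  induction e with
  | _ x y =>
    rw [SimpleGraph.mem_edgeSet] at he
    rcases x with i | i <;> rcases y with j | j
    · simp [Ktilde, SimpleGraph.deleteEdges_adj] at he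
    · exact ⟨i, j, ktilde_adj_inl_inr.mp he, rfl⟩
    · exact ⟨j, i, ktilde_adj_inl_inr.mp he.symm, Sym2.eq_swap⟩
    · simp [Ktilde, SimpleGraph.deleteEdges_adj] at he

/-- The cyclic sequence `q` of four vertices traverses a simple cycle of length 4 in `G`. -/
def IsFourCycle {V : Type*} (G : SimpleGraph V) (q : V × V × V × V) : Prop :=
  (q.1 ≠ q.2.1 ∧ q.1 ≠ q.2.2.1 ∧ q.1 ≠ q.2.2.2 ∧ q.2.1 ≠ q.2.2.1 ∧
    q.2.1 ≠ q.2.2.2 ∧ q.2.2.1 ≠ q.2.2.2) ∧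
  G.Adj q.1 q.2.1 ∧ G.Adj q.2.1 q.2.2.1 ∧ G.Adj q.2.2.1 q.2.2.2 ∧ G.Adj q.2.2.2 q.1

/-- The edge `e` is one of the sides of the quadrilateral `q`. -/
def IsSide {V : Type*} (q : V × V × V × V) (e : Sym2 V) : Prop :=
  e = s(q.1, q.2.1) ∨ e = s(q.2.1, q.2.2.1) ∨ e = s(q.2.2.1, q.2.2.2) ∨ e = s(q.2.2.2, q.1)

/-- The indicator function modulo 2 of the sides of the quadrilateral `q`. -/
noncomputable def sideVector {V : Type*} (q : V × V × V × V) : Sym2 V → ZMod 2 :=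
  fun e => if IsSide q e then 1 else 0

theorem sideVector_eq_sum_single {V : Type*} [DecidableEq V] {G : SimpleGraph V} {q : V × V × V × V}
    (hq : IsFourCycle G q) :
    sideVector q = Pi.single s(q.1, q.2.1) 1 + Pi.single s(q.2.1, q.2.2.1) 1 +
      Pi.single s(q.2.2.1, q.2.2.2) 1 + Pi.single s(q.2.2.2, q.1) 1 := by
  obtain ⟨a, b, c, d⟩ := q
  obtain ⟨⟨hab, hac, had, hbc, hbd, hcd⟩, -⟩ := hq
  dsimp only at *
  have h12 : s(a, b) ≠ s(b, c) := by simp [*]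
  have h13 : s(a, b) ≠ s(c, d) := by simp [*]
  have h14 : s(a, b) ≠ s(d, a) := by simp [*]
  have h23 : s(b, c) ≠ s(c, d) := by simp [*]
  have h24 : s(b, c) ≠ s(d, a) := by simp [*, hab.symm]
  have h34 : s(c, d) ≠ s(d, a) := by simp [*, hac.symm]
  funext e
  simp only [sideVector, IsSide, Pi.add_apply, Pi.single_apply]
  grind

/-- A set of edges whose indicator lies in the span of the 4-cycles is a sum of 4-cycles. -/
theorem exists_finset_of_mem_span_sideVector {V : Type*} [DecidableEq V] {G : SimpleGraph V}
    {C : Finset (Sym2 V)}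
    (hC : (fun e => if e ∈ C then 1 else 0) ∈
      Submodule.span (ZMod 2) (sideVector '' {q | IsFourCycle G q})) :
    ∃ S : Finset (V × V × V × V), (∀ q ∈ S, IsFourCycle G q) ∧
      ∀ e, e ∈ C ↔ Odd (S.filter fun q => IsSide q e).card := by
  obtain ⟨l, hl, hx⟩ := (Finsupp.mem_span_image_iff_linearCombination (ZMod 2)).mp hC
  refine ⟨l.support, fun q hq => hl hq, fun e => ?_⟩
  have coeff : ∀ q ∈ l.support, l q = 1 := fun q hq =>
    Fin.eq_one_of_ne_zero (l q) (Finsupp.mem_support_iff.mp hq)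
  have hcard : (if e ∈ C then (1 : ZMod 2) else 0) =
      ((l.support.filter fun q => IsSide q e).card : ZMod 2) := by
    rw [← congrFun hx e, Finsupp.linearCombination_apply, Finsupp.sum, Finset.sum_apply,
      Finset.natCast_card_filter]
    refine Finset.sum_congr rfl fun q hq => ?_
    simp [coeff q hq, sideVector]
  rw [← ZMod.natCast_eq_one_iff_odd, ← hcard]
  simp

theorem indicator_mem_span_sideVector {n : ℕ} (hn : 4 ≤ n) {C : Finset (Sym2 (Fin n ⊕ Fin n))}
    (hC : IsOneCycle (Ktilde n) C) :
    (fun e => if e ∈ C then 1 else 0) ∈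
      Submodule.span (ZMod 2) (sideVector '' {q | IsFourCycle (Ktilde n) q}) := by
  by_contra hmem
  obtain ⟨φ, hφ, hle⟩ := Submodule.exists_le_ker_of_notMem hmem
  apply hφ
  obtain ⟨u, v, huv⟩ := exists_eq_add_of_rectangle_sum_eq_zero (α := Fin n) (by simpa using hn)
    (fun i j => φ (Pi.single s(Sum.inl i, Sum.inr j) 1)) (by
      intro a b c d hab hcd hac had hbc hbd
      have hq : IsFourCycle (Ktilde n) (Sum.inl a, Sum.inr c, Sum.inl b, Sum.inr d) :=
        ⟨by simp [hab, hcd], ktilde_adj_inl_inr.mpr hac, (ktilde_adj_inl_inr.mpr hbc).symm,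
          ktilde_adj_inl_inr.mpr hbd, (ktilde_adj_inl_inr.mpr had).symm⟩
      have h := hle (Submodule.subset_span ⟨_, hq, rfl⟩)
      rw [LinearMap.mem_ker, sideVector_eq_sum_single hq] at h
      simpa [Sym2.eq_swap (a := Sum.inr c), Sym2.eq_swap (a := Sum.inr d)] using h)
  have hsum : (fun e => if e ∈ C then (1 : ZMod 2) else 0) = ∑ e ∈ C, Pi.single e 1 := by
    funext e
    simp [Finset.sum_apply, Pi.single_apply]
  rw [hsum, map_sum, ← hC.sum_endpoint_weights_eq_zero (Sum.elim u v)]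
  refine Finset.sum_congr rfl fun e he => ?_
  obtain ⟨i, j, hij, rfl⟩ := exists_eq_of_mem_edgeSet_ktilde (hC.1 e he)
  rw [huv i j hij]
  have hfilter : (Finset.univ.filter fun x => x ∈ s(Sum.inl i, Sum.inr j)) =
      ({Sum.inl i, Sum.inr j} : Finset (Fin n ⊕ Fin n)) := by
    ext x
    simp
  rw [hfilter, Finset.sum_pair (by simp)]
  rfl

/-- For `n ≥ 4`, every 1-cycle in `K̃_n` is a sum (mod 2) of edge sets of
finitely many simple cycles of length 4 of `K̃_n`. -/
theorem stmt_7 (n : ℕ) (hn : 4 ≤ n) (C : Finset (Sym2 (Fin n ⊕ Fin n)))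
    (hC : IsOneCycle (Ktilde n) C) :
    ∃ S : Finset ((Fin n ⊕ Fin n) × (Fin n ⊕ Fin n) × (Fin n ⊕ Fin n) × (Fin n ⊕ Fin n)),
      (∀ q ∈ S,
        (q.1 ≠ q.2.1 ∧ q.1 ≠ q.2.2.1 ∧ q.1 ≠ q.2.2.2 ∧ q.2.1 ≠ q.2.2.1 ∧
          q.2.1 ≠ q.2.2.2 ∧ q.2.2.1 ≠ q.2.2.2) ∧
        (Ktilde n).Adj q.1 q.2.1 ∧ (Ktilde n).Adj q.2.1 q.2.2.1 ∧
        (Ktilde n).Adj q.2.2.1 q.2.2.2 ∧ (Ktilde n).Adj q.2.2.2 q.1) ∧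
      ∀ e : Sym2 (Fin n ⊕ Fin n), e ∈ C ↔
        Odd ((S.filter (fun q =>
          e = s(q.1, q.2.1) ∨ e = s(q.2.1, q.2.2.1) ∨
          e = s(q.2.2.1, q.2.2.2) ∨ e = s(q.2.2.2, q.1))).card) := by
  obtain ⟨S, hS, hmem⟩ :=
    exists_finset_of_mem_span_sideVector (indicator_mem_span_sideVector hn hC)
  refine ⟨S, hS, fun e => ?_⟩
  rw [hmem e]
  convert Iff.rfl using 4
  rfl
end

section
/- Let K be a finite connected graph and T a spanning tree of K. Then every assignment of integers to the edges of K not in T extends uniquely to an integer 1-cycle of K. Equivalently, the restriction map from integer 1-cycles of K to integer-valued functions on the edges of K outside T is a bijection. -/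
open scoped Classical

/-- The double sum of an antisymmetric integer function over a square index set vanishes. -/
theorem Finset.sum_sum_eq_zero_of_antisymm {ι : Type*} (s : Finset ι) {f : ι → ι → ℤ}
    (hanti : ∀ a b, f a b = - f b a) : ∑ a ∈ s, ∑ b ∈ s, f a b = 0 := by
  have key : ∑ a ∈ s, ∑ b ∈ s, f a b = - ∑ a ∈ s, ∑ b ∈ s, f a b := by
    conv_lhs => rw [Finset.sum_comm]
    simp only [← Finset.sum_neg_distrib]
    exact Finset.sum_congr rfl fun a _ => Finset.sum_congr rfl fun b _ => hanti b a
  omega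

namespace SimpleGraph

variable {V : Type*} [Fintype V] {G : SimpleGraph V}

/-- A walk from `u` to `v` carries an integer flow with divergence `δ_u - δ_v`. -/
theorem Walk.exists_unit_flow {u v : V} (p : G.Walk u v) :
    ∃ f : V → V → ℤ, (∀ a b, f a b = - f b a) ∧ (∀ a b, ¬ G.Adj a b → f a b = 0) ∧
      ∀ a, ∑ b, f a b = (if a = u then 1 else 0) - (if a = v then 1 else 0) := by
  induction p with
  | nil => exact ⟨fun _ _ => 0, by simp, by simp, by simp⟩
  | @cons u w v huw p ih =>
    obtain ⟨f, hanti, hsupp, hdiv⟩ := ih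
    refine ⟨fun a b => f a b + ((if a = u then 1 else 0) * (if b = w then 1 else 0)
      - (if a = w then 1 else 0) * (if b = u then 1 else 0)), fun a b => ?_, fun a b hab => ?_,
      fun a => ?_⟩
    · simp only [hanti a b]
      ring
    · have hleft : ¬ (a = u ∧ b = w) := by
        rintro ⟨rfl, rfl⟩
        exact hab huw
      have hright : ¬ (a = w ∧ b = u) := by
        rintro ⟨rfl, rfl⟩
        exact hab huw.symm
      simp only [hsupp a b hab]
      split_ifs <;> tauto
    · simp only [Finset.sum_add_distrib, Finset.sum_sub_distrib, ← Finset.mul_sum, hdiv a,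
        Finset.sum_ite_eq', Finset.mem_univ, if_true]
      simp

/-- On a finite connected graph, every integer function of total sum zero is the divergence of
an integer flow. -/
theorem Connected.exists_flow_of_sum_eq_zero (hG : G.Connected) (h : V → ℤ) (hh : ∑ v, h v = 0) :
    ∃ f : V → V → ℤ, (∀ a b, f a b = - f b a) ∧ (∀ a b, ¬ G.Adj a b → f a b = 0) ∧
      ∀ a, ∑ b, f a b = h a := by
  obtain ⟨r⟩ := hG.nonempty
  choose φ hanti hsupp hdiv using fun v => (hG.preconnected v r).some.exists_unit_flow
  refine ⟨fun a b => ∑ v, h v * φ v a b, fun a b => ?_, fun a b hab => ?_, fun a => ?_⟩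
  · rw [← Finset.sum_neg_distrib]
    exact Finset.sum_congr rfl fun v _ => by rw [hanti v a b, mul_neg]
  · exact Finset.sum_eq_zero fun v _ => by rw [hsupp v a b hab, mul_zero]
  · rw [Finset.sum_comm]
    simp only [← Finset.mul_sum, hdiv, mul_sub, Finset.sum_sub_distrib, ← Finset.sum_mul, hh]
    simp

/-- An integer 1-cycle on a finite acyclic graph is zero. -/
theorem IsAcyclic.cycle_eq_zero (hG : G.IsAcyclic) {f : V → V → ℤ}
    (hanti : ∀ a b, f a b = - f b a) (hsupp : ∀ a b, ¬ G.Adj a b → f a b = 0)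
    (hdiv : ∀ a, ∑ b, f a b = 0) (a b : V) : f a b = 0 := by
  by_cases hab : G.Adj a b
  swap
  · exact hsupp a b hab
  have hbridge : ¬ (G.deleteEdges {s(a, b)}).Reachable a b :=
    isBridge_iff.mp (isAcyclic_iff_forall_adj_isBridge.mp hG hab)
  let S : Finset V := {x | (G.deleteEdges {s(a, b)}).Reachable a x}
  have haS : a ∈ S := by simp [S]
  have hbS : b ∉ S := by simpa [S] using hbridge
  have hcut : ∀ x ∈ S, ∀ y ∉ S, ¬ (x = a ∧ y = b) → f x y = 0 := by
    intro x hx y hy hne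
    refine hsupp x y fun hxy => hy ?_
    simp only [S, Finset.mem_filter, Finset.mem_univ, true_and] at hx ⊢
    refine hx.trans (Adj.reachable (deleteEdges_adj.mpr ⟨hxy, fun he => ?_⟩))
    rcases Sym2.eq_iff.mp he with h | ⟨rfl, rfl⟩
    · exact hne h
    · exact hbridge hx
  have htotal : ∑ x ∈ S, ∑ y, f x y = 0 := Finset.sum_eq_zero fun x _ => hdiv x
  have hsplit : ∑ x ∈ S, ∑ y, f x y = ∑ x ∈ S, ∑ y ∈ S, f x y + ∑ x ∈ S, ∑ y ∈ Sᶜ, f x y := by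
    rw [← Finset.sum_add_distrib]
    exact Finset.sum_congr rfl fun x _ => (Finset.sum_add_sum_compl S _).symm
  have hout : ∑ x ∈ S, ∑ y ∈ Sᶜ, f x y = f a b := by
    rw [Finset.sum_eq_single_of_mem a haS, Finset.sum_eq_single_of_mem b (by simpa using hbS)]
    · exact fun y hy hyb => hcut a haS y (by simpa using hy) fun h => hyb h.2
    · exact fun x hx hxa => Finset.sum_eq_zero fun y hy =>
        hcut x hx y (by simpa using hy) fun h => hxa h.1
  rw [← hout]
  linarith [S.sum_sum_eq_zero_of_antisymm hanti]

end SimpleGraph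

/-- Let `K` be a finite connected graph and `T` a spanning tree of `K`
(a subgraph on the same vertex set which is a tree). Every assignment of
integers to the edges of `K` not in `T` extends uniquely to an integer 1-cycle
of `K`. Integer 1-cycles are encoded as antisymmetric integer-valued functions
on ordered pairs of vertices, vanishing on non-edges and satisfying the
Kirchhoff rule at each vertex. -/
theorem stmt_8 {V : Type*} [Fintype V] (K T : SimpleGraph V)
    (hK : K.Connected) (hT : T ≤ K) (hTree : T.IsTree)
    (g : V → V → ℤ) (hg : ∀ a b, g a b = - g b a) :
    ∃! f : V → V → ℤ,
      (∀ a b, f a b = - f b a) ∧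
      (∀ a b, ¬ K.Adj a b → f a b = 0) ∧
      (∀ a : V, ∑ b : V, f a b = 0) ∧
      (∀ a b, K.Adj a b → ¬ T.Adj a b → f a b = g a b) := by
  let c : V → V → ℤ := fun a b => if K.Adj a b ∧ ¬ T.Adj a b then g a b else 0
  have hc : ∀ a b, c a b = - c b a := by
    intro a b
    simp only [c, K.adj_comm b a, T.adj_comm b a, hg a b]
    split_ifs <;> simp
  obtain ⟨t, hanti, hsupp, hdiv⟩ :=
    hTree.connected.exists_flow_of_sum_eq_zero (fun a => - ∑ b, c a b) (by
      rw [Finset.sum_neg_distrib, Finset.sum_sum_eq_zero_of_antisymm _ hc, neg_zero])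
  refine ⟨fun a b => c a b + t a b, ⟨fun a b => ?_, fun a b hab => ?_, fun a => ?_,
    fun a b hK' hT' => ?_⟩, ?_⟩
  · simp only [hc a b, hanti a b]
    ring
  · simp [c, hab, hsupp a b fun h => hab (hT h)]
  · simp [Finset.sum_add_distrib, hdiv]
  · simp [c, hK', hT', hsupp a b hT']
  · rintro f ⟨fanti, fsupp, fdiv, fext⟩
    funext a b
    have hzero := hTree.isAcyclic.cycle_eq_zero (f := fun a b => f a b - (c a b + t a b))
      (fun a b => by simp only [fanti a b, hc a b, hanti a b]; ring)
      (fun a b hab => by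
        by_cases hKab : K.Adj a b
        · simp [c, hKab, hab, hsupp a b hab, fext a b hKab hab]
        · simp [c, hKab, hsupp a b hab, fsupp a b hKab])
      (fun a => by simp [Finset.sum_sub_distrib, Finset.sum_add_distrib, hdiv, fdiv]) a b
    exact sub_eq_zero.mp hzero
end

section
/- (Künneth theorem for 1-cycles) Let K be a finite connected graph, a a vertex of K, and C a 1-cycle in K□K. Then there exist unique 1-cycles C₁, C₂ in K such that C + C₁×a + a×C₂ is a sum of boundaries; moreover one can take C₁ = C_x and C₂ = C_y, the right and left projections of C. -/
open scoped Classical symmDiff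

/-- The boundary `ab □ uv`: the edge set of the 4-cycle
`(a,u)(b,u)(b,v)(a,v)` in the box product. -/
def bdry {V : Type*} [DecidableEq V] (a b u v : V) : Finset (Sym2 (V × V)) :=
  {s((a, u), (b, u)), s((b, u), (b, v)), s((b, v), (a, v)), s((a, v), (a, u))}

/-- `Z` is a sum (mod 2) of boundaries `ab □ uv` over edges `ab`, `uv` of `K`. -/
def IsSumOfBoundaries {V : Type*} [Fintype V] [DecidableEq V] (K : SimpleGraph V)
    (Z : Finset (Sym2 (V × V))) : Prop :=
  ∃ S : Finset (V × V × V × V),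
    (∀ q ∈ S, K.Adj q.1 q.2.1 ∧ K.Adj q.2.2.1 q.2.2.2) ∧
    ∀ e : Sym2 (V × V), e ∈ Z ↔
      Odd ((S.filter (fun q => e ∈ bdry q.1 q.2.1 q.2.2.1 q.2.2.2)).card)

/-- The left cycle `a × D` in `K □ K`, for a set of edges `D` of `K`. -/
def leftCyc {V : Type*} [DecidableEq V] (a : V) (D : Finset (Sym2 V)) :
    Finset (Sym2 (V × V)) :=
  D.image (Sym2.map (fun v => (a, v)))

/-- The right cycle `D × a` in `K □ K`, for a set of edges `D` of `K`. -/
def rightCyc {V : Type*} [DecidableEq V] (a : V) (D : Finset (Sym2 V)) :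
    Finset (Sym2 (V × V)) :=
  D.image (Sym2.map (fun v => (v, a)))

/-- The left projection `C_y` of a set `C` of edges of `K □ K`: the set of
edges `σ` of `K` such that there is an odd number of vertices `b` with
`b × σ ∈ C`. -/
def projY {V : Type*} [Fintype V] [DecidableEq V] (C : Finset (Sym2 (V × V))) :
    Finset (Sym2 V) :=
  Finset.univ.filter (fun σ : Sym2 V =>
    Odd ((Finset.univ.filter (fun b : V => Sym2.map (fun v => (b, v)) σ ∈ C)).card))

/-- The right projection `C_x` of a set `C` of edges of `K □ K`. -/
def projX {V : Type*} [Fintype V] [DecidableEq V] (C : Finset (Sym2 (V × V))) :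
    Finset (Sym2 V) :=
  Finset.univ.filter (fun σ : Sym2 V =>
    Odd ((Finset.univ.filter (fun b : V => Sym2.map (fun v => (v, b)) σ ∈ C)).card))

theorem nsmul_eq_ite_odd {M : Type*} [AddCommGroup M] [Module (ZMod 2) M] (n : ℕ) (x : M) :
    n • x = if Odd n then x else 0 := by
  have two_nsmul_zero : 2 • x = 0 := by rw [two_nsmul, ZModModule.add_self]
  split_ifs with h
  · obtain ⟨k, rfl⟩ := h
    rw [add_nsmul, mul_nsmul, two_nsmul_zero, one_nsmul, nsmul_zero, zero_add]
  · obtain ⟨k, rfl⟩ := Nat.not_odd_iff_even.mp h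
    rw [← two_mul, mul_nsmul, two_nsmul_zero, nsmul_zero]

theorem add_eq_zero_iff_eq_of_charTwo {M : Type*} [AddCommGroup M] [Module (ZMod 2) M]
    {x y : M} : x + y = 0 ↔ x = y := by
  rw [add_eq_zero_iff_eq_neg, ZModModule.neg_eq_self]

theorem sum_symmDiff_charTwo {M : Type*} [AddCommGroup M] [Module (ZMod 2) M]
    {α : Type*} [Fintype α] [DecidableEq α] (A B : Finset α) (F : α → M) :
    ∑ e ∈ A ∆ B, F e = ∑ e ∈ A, F e + ∑ e ∈ B, F e := by
  have h (T : Finset α) : ∑ e ∈ T, F e = ∑ e, if e ∈ T then F e else 0 := by simp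
  rw [h, h A, h B, ← Finset.sum_add_distrib]
  refine Finset.sum_congr rfl fun e _ => ?_
  by_cases hA : e ∈ A <;> by_cases hB : e ∈ B <;>
    simp [Finset.mem_symmDiff, hA, hB, ZModModule.add_self]

/-- The coboundary of a vertex function, taken modulo 2. -/
def coboundary {M V : Type*} [AddCommGroup M] (f : V → M) : Sym2 V → M :=
  Sym2.lift ⟨fun x y => f x + f y, fun _ _ => add_comm _ _⟩

@[simp]
theorem coboundary_mk {M V : Type*} [AddCommGroup M] (f : V → M) (x y : V) :
    coboundary f s(x, y) = f x + f y := rfl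

theorem coboundary_eq_sum {M V : Type*} [AddCommGroup M] [Fintype V] (f : V → M)
    {e : Sym2 V} (he : ¬ e.IsDiag) : coboundary f e = ∑ v with v ∈ e, f v := by
  induction e with | h x y =>
  have hxy : x ≠ y := he
  rw [coboundary_mk, ← Finset.sum_pair hxy]
  congr 1
  ext v
  simp

theorem IsOneCycle.sum_coboundary {M V : Type*} [AddCommGroup M] [Module (ZMod 2) M]
    [Fintype V] {G : SimpleGraph V} {C : Finset (Sym2 V)} (hC : IsOneCycle G C) (f : V → M) :
    ∑ e ∈ C, coboundary f e = 0 := by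
  have h : ∑ e ∈ C, coboundary f e = ∑ e ∈ C, ∑ v : V, if v ∈ e then f v else 0 := by
    refine Finset.sum_congr rfl fun e he => ?_
    rw [coboundary_eq_sum f (G.not_isDiag_of_mem_edgeSet (hC.1 e he)), Finset.sum_filter]
  rw [h, Finset.sum_comm]
  refine Finset.sum_eq_zero fun v _ => ?_
  rw [← Finset.sum_filter, Finset.sum_const, nsmul_eq_ite_odd, if_neg]
  simpa using hC.2 v

theorem isOneCycle_of_sum_coboundary {V : Type*} [Fintype V] {G : SimpleGraph V}
    {C : Finset (Sym2 V)} (hG : ∀ e ∈ C, e ∈ G.edgeSet)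
    (h : ∀ f : V → ZMod 2, ∑ e ∈ C, coboundary f e = 0) : IsOneCycle G C := by
  refine ⟨hG, fun v => ?_⟩
  rw [← ZMod.natCast_eq_zero_iff_even, ← h (Pi.single v 1), Finset.card_filter, Nat.cast_sum]
  refine Finset.sum_congr rfl fun e he => ?_
  rw [coboundary_eq_sum _ (G.not_isDiag_of_mem_edgeSet (hG e he))]
  simp [Pi.single_apply]

theorem map_mk_left_mem_edgeSet {V : Type*} {K : SimpleGraph V} {b : V} {σ : Sym2 V} :
    Sym2.map (fun v => (b, v)) σ ∈ (K □ K).edgeSet ↔ σ ∈ K.edgeSet := by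
  induction σ with | h x y => simp

theorem map_mk_right_mem_edgeSet {V : Type*} {K : SimpleGraph V} {b : V} {σ : Sym2 V} :
    Sym2.map (fun v => (v, b)) σ ∈ (K □ K).edgeSet ↔ σ ∈ K.edgeSet := by
  induction σ with | h x y => simp

theorem SimpleGraph.Connected.eq_of_forall_adj {V α : Type*} {K : SimpleGraph V}
    (hK : K.Connected) {k : V → α} (hk : ∀ u v, K.Adj u v → k u = k v) (u v : V) : k u = k v := by
  obtain ⟨w⟩ := hK.preconnected u v
  induction w with
  | nil => rfl
  | cons h _ ih => exact (hk _ _ h).trans ih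

section Product

variable {V : Type*} [DecidableEq V] {K : SimpleGraph V} {M : Type*} [AddCommGroup M]

theorem sum_leftCyc (a : V) (D : Finset (Sym2 V)) (F : Sym2 (V × V) → M) :
    ∑ e ∈ leftCyc a D, F e = ∑ σ ∈ D, F (Sym2.map (fun v => (a, v)) σ) :=
  Finset.sum_image (Sym2.map.injective (Prod.mk_right_injective a)).injOn

theorem sum_rightCyc (a : V) (D : Finset (Sym2 V)) (F : Sym2 (V × V) → M) :
    ∑ e ∈ rightCyc a D, F e = ∑ σ ∈ D, F (Sym2.map (fun v => (v, a)) σ) :=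
  Finset.sum_image (Sym2.map.injective (Prod.mk_left_injective a)).injOn

theorem sum_bdry {a b u v : V} (hab : K.Adj a b) (huv : K.Adj u v) (F : Sym2 (V × V) → M) :
    ∑ e ∈ bdry a b u v, F e = F s((a, u), (b, u)) + F s((b, u), (b, v)) +
      F s((a, v), (b, v)) + F s((a, u), (a, v)) := by
  have h₁ := hab.ne
  have h₂ := huv.ne
  rw [bdry, Finset.sum_insert, Finset.sum_insert, Finset.sum_pair,
    Sym2.eq_swap (a := (b, v)) (b := (a, v)), Sym2.eq_swap (a := (a, v)) (b := (a, u))]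
  · simp only [add_assoc]
  all_goals
    simp
    try grind

theorem eq_of_sum_eq {D E : Finset (Sym2 V)} (hD : ∀ e ∈ D, ¬ e.IsDiag)
    (hE : ∀ e ∈ E, ¬ e.IsDiag)
    (h : ∀ G : Sym2 V → ZMod 2, (∀ v, G s(v, v) = 0) → ∑ e ∈ D, G e = ∑ e ∈ E, G e) :
    D = E := by
  ext σ
  by_cases hσ : σ.IsDiag
  · exact iff_of_false (fun h => hD σ h hσ) (fun h => hE σ h hσ)
  · have hs := h (Pi.single σ 1) fun v =>
      Pi.single_eq_of_ne (by rintro rfl; exact hσ rfl) _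
    simp only [Pi.single_apply, Finset.sum_ite_eq'] at hs
    split_ifs at hs <;> simp_all

section Primitive

variable [Module (ZMod 2) M]

/-- Moving an edge `b × σ` to `a × σ` changes a cocycle by a coboundary. -/
theorem exists_primitive_column (hK : K.Connected) {F : Sym2 (V × V) → M}
    (hF : ∀ a b u v, K.Adj a b → K.Adj u v → ∑ e ∈ bdry a b u v, F e = 0) (a b : V) :
    ∃ g : V → M, g a = 0 ∧
      ∀ u v, K.Adj u v → g u + g v = F s((b, u), (b, v)) + F s((a, u), (a, v)) := by
  obtain ⟨w⟩ := hK.preconnected b a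
  induction w with
  | nil => exact ⟨0, rfl, fun u v _ => by simp [ZModModule.add_self]⟩
  | @cons b c a hbc _ ih =>
    obtain ⟨g, hga, hg⟩ := ih
    refine ⟨fun u => g u + (F s((b, u), (c, u)) + F s((b, a), (c, a))), ?_, fun u v huv => ?_⟩
    · simp [hga, ZModModule.add_self]
    · have hbd := hF _ _ _ _ hbc huv
      rw [sum_bdry hbc huv] at hbd
      have h₁ := ZModModule.add_self (F s((b, a), (c, a)))
      have h₂ := ZModModule.add_self (F s((b, u), (b, v)))
      have h₃ := ZModModule.add_self (F s((c, u), (c, v)))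
      have h₄ := hg u v huv
      grind

/-- A cocycle on `K □ K` is cohomologous to its translate onto the two axes through `a`. -/
theorem exists_primitive (hK : K.Connected) {F : Sym2 (V × V) → M}
    (hF : ∀ a b u v, K.Adj a b → K.Adj u v → ∑ e ∈ bdry a b u v, F e = 0) (a : V) :
    ∃ f : V × V → M,
      (∀ b u v, K.Adj u v →
        f (b, u) + f (b, v) = F s((b, u), (b, v)) + F s((a, u), (a, v))) ∧
      ∀ b u v, K.Adj u v →
        f (u, b) + f (v, b) = F s((u, b), (v, b)) + F s((u, a), (v, a)) := by
  choose g hga hg using exists_primitive_column hK hF a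
  refine ⟨fun p => g p.1 p.2, hg, fun b x y hxy => ?_⟩
  have key := hK.eq_of_forall_adj
    (k := fun u => g x u + g y u + (F s((x, u), (y, u)) + F s((x, a), (y, a)))) (fun u v huv => ?_)
    b a
  · simpa [hga, ZModModule.add_self, add_eq_zero_iff_eq_of_charTwo] using key
  · rw [← add_eq_zero_iff_eq_of_charTwo]
    have hbd := hF _ _ _ _ hxy huv
    rw [sum_bdry hxy huv] at hbd
    have h₁ := ZModModule.add_self (F s((x, a), (y, a)))
    have h₂ := ZModModule.add_self (F s((a, u), (a, v)))
    have h₃ := hg x u v huv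
    have h₄ := hg y u v huv
    grind

end Primitive

variable [Fintype V]

/-- A sum over edges of `K □ K` splits into the sums over the edges `b × σ` and `σ × b`. -/
theorem sum_edges_boxProd {C : Finset (Sym2 (V × V))}
    (hC : ∀ e ∈ C, e ∈ (K □ K).edgeSet) (F : Sym2 (V × V) → M) :
    ∑ e ∈ C, F e =
      (∑ σ : Sym2 V, ∑ b with Sym2.map (fun v => (b, v)) σ ∈ C, F (Sym2.map (fun v => (b, v)) σ)) +
      ∑ σ : Sym2 V, ∑ b with Sym2.map (fun v => (v, b)) σ ∈ C,
        F (Sym2.map (fun v => (v, b)) σ) := by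
  let i : (Sym2 V × V) ⊕ (Sym2 V × V) → Sym2 (V × V) :=
    Sum.elim (fun p => Sym2.map (fun v => (p.2, v)) p.1) (fun p => Sym2.map (fun v => (v, p.2)) p.1)
  have h : ∑ x with i x ∈ C, F (i x) = ∑ e ∈ C, F e := by
    refine Finset.sum_nbij i (by simp) ?_ ?_ (fun _ _ => rfl)
    · rintro (⟨σ, b⟩ | ⟨σ, b⟩) hx (⟨τ, c⟩ | ⟨τ, c⟩) hy hxy <;>
      · simp only [Finset.coe_filter, Finset.mem_univ, true_and, Set.mem_ofPred_eq, i, Sum.elim_inl,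
          Sum.elim_inr] at hx hy hxy
        replace hx := hC _ hx
        replace hy := hC _ hy
        induction σ with | h x y =>
        induction τ with | h z w =>
        simp at hx hy
        have := hx.ne
        simp at hxy ⊢
        grind
    · intro e he
      have hadj := hC e he
      induction e with | h x y =>
      obtain ⟨x₁, x₂⟩ := x
      obtain ⟨y₁, y₂⟩ := y
      rw [SimpleGraph.mem_edgeSet, SimpleGraph.boxProd_adj] at hadj
      obtain ⟨-, rfl⟩ | ⟨-, rfl⟩ := hadj
      · exact ⟨Sum.inr (s(x₁, y₁), x₂), by simpa [i] using he, rfl⟩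
      · exact ⟨Sum.inl (s(x₂, y₂), x₁), by simpa [i] using he, rfl⟩
  rw [← h, Finset.sum_filter, Fintype.sum_sum_type, Fintype.sum_prod_type, Fintype.sum_prod_type]
  simp only [Finset.sum_filter, i, Sum.elim_inl, Sum.elim_inr]

theorem mem_edgeSet_of_mem_projY {C : Finset (Sym2 (V × V))}
    (hC : ∀ e ∈ C, e ∈ (K □ K).edgeSet) {σ : Sym2 V} (hσ : σ ∈ projY C) : σ ∈ K.edgeSet := by
  obtain ⟨b, hb⟩ := Finset.card_pos.mp (Finset.mem_filter.mp hσ).2.pos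
  exact map_mk_left_mem_edgeSet.mp (hC _ (Finset.mem_filter.mp hb).2)

theorem mem_edgeSet_of_mem_projX {C : Finset (Sym2 (V × V))}
    (hC : ∀ e ∈ C, e ∈ (K □ K).edgeSet) {σ : Sym2 V} (hσ : σ ∈ projX C) : σ ∈ K.edgeSet := by
  obtain ⟨b, hb⟩ := Finset.card_pos.mp (Finset.mem_filter.mp hσ).2.pos
  exact map_mk_right_mem_edgeSet.mp (hC _ (Finset.mem_filter.mp hb).2)

variable [Module (ZMod 2) M]

/-- If a function on edges of `K □ K` is independent of the constant coordinate, its sum over `C`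
only depends on the projections of `C`. -/
theorem sum_eq_sum_projections {C : Finset (Sym2 (V × V))}
    (hC : ∀ e ∈ C, e ∈ (K □ K).edgeSet) {F : Sym2 (V × V) → M} {G H : Sym2 V → M}
    (hG : ∀ σ ∈ K.edgeSet, ∀ b, F (Sym2.map (fun v => (b, v)) σ) = G σ)
    (hH : ∀ σ ∈ K.edgeSet, ∀ b, F (Sym2.map (fun v => (v, b)) σ) = H σ) :
    ∑ e ∈ C, F e = ∑ σ ∈ projX C, H σ + ∑ σ ∈ projY C, G σ := by
  rw [sum_edges_boxProd hC, add_comm, projX, projY, Finset.sum_filter, Finset.sum_filter]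
  congr 1 <;> refine Finset.sum_congr rfl fun σ _ => ?_
  · rw [← nsmul_eq_ite_odd, ← Finset.sum_const]
    refine Finset.sum_congr rfl fun b hb => hH σ ?_ b
    exact map_mk_right_mem_edgeSet.mp (hC _ (Finset.mem_filter.mp hb).2)
  · rw [← nsmul_eq_ite_odd, ← Finset.sum_const]
    refine Finset.sum_congr rfl fun b hb => hG σ ?_ b
    exact map_mk_left_mem_edgeSet.mp (hC _ (Finset.mem_filter.mp hb).2)

theorem isOneCycle_projX {C : Finset (Sym2 (V × V))} (hC : IsOneCycle (K □ K) C) :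
    IsOneCycle K (projX C) := by
  refine isOneCycle_of_sum_coboundary (fun σ => mem_edgeSet_of_mem_projX hC.1) fun f => ?_
  rw [← hC.sum_coboundary fun p => f p.1,
    sum_eq_sum_projections hC.1 (G := 0) (H := coboundary f)]
  · simp
  · rintro ⟨x, y⟩ - b
    exact ZModModule.add_self _
  · rintro ⟨x, y⟩ - b
    rfl

theorem isOneCycle_projY {C : Finset (Sym2 (V × V))} (hC : IsOneCycle (K □ K) C) :
    IsOneCycle K (projY C) := by
  refine isOneCycle_of_sum_coboundary (fun σ => mem_edgeSet_of_mem_projY hC.1) fun f => ?_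
  rw [← hC.sum_coboundary fun p => f p.2,
    sum_eq_sum_projections hC.1 (G := coboundary f) (H := 0)]
  · simp
  · rintro ⟨x, y⟩ - b
    rfl
  · rintro ⟨x, y⟩ - b
    exact ZModModule.add_self _

/-- An edge function vanishing on boundaries vanishes on sums of boundaries. -/
theorem IsSumOfBoundaries.sum_eq_zero {Z : Finset (Sym2 (V × V))} (hZ : IsSumOfBoundaries K Z)
    {F : Sym2 (V × V) → M}
    (hF : ∀ a b u v, K.Adj a b → K.Adj u v → ∑ e ∈ bdry a b u v, F e = 0) :
    ∑ e ∈ Z, F e = 0 := by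
  obtain ⟨S, hS, hZS⟩ := hZ
  calc ∑ e ∈ Z, F e
      = ∑ e, ∑ q ∈ S, if e ∈ bdry q.1 q.2.1 q.2.2.1 q.2.2.2 then F e else 0 := by
        rw [← Finset.univ_inter Z, ← Finset.sum_ite_mem]
        refine Finset.sum_congr rfl fun e _ => ?_
        rw [← Finset.sum_filter, Finset.sum_const, nsmul_eq_ite_odd]
        simp only [hZS]
    _ = ∑ q ∈ S, ∑ e ∈ bdry q.1 q.2.1 q.2.2.1 q.2.2.2, F e := by
        rw [Finset.sum_comm]
        simp
    _ = 0 := Finset.sum_eq_zero fun q hq => hF _ _ _ _ (hS q hq).1 (hS q hq).2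

variable (K) in
/-- The submodule of sums of boundaries in the space of edge chains modulo 2 of `K □ K`. -/
def boundarySubmodule : Submodule (ZMod 2) (Sym2 (V × V) → ZMod 2) :=
  Submodule.span (ZMod 2) {x | ∃ a b u v, K.Adj a b ∧ K.Adj u v ∧
    x = ∑ e ∈ bdry a b u v, Pi.single e 1}

theorem exists_finset_of_mem_boundarySubmodule {x : Sym2 (V × V) → ZMod 2}
    (hx : x ∈ boundarySubmodule K) :
    ∃ S : Finset (V × V × V × V), (∀ q ∈ S, K.Adj q.1 q.2.1 ∧ K.Adj q.2.2.1 q.2.2.2) ∧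
      x = ∑ q ∈ S, ∑ e ∈ bdry q.1 q.2.1 q.2.2.1 q.2.2.2, Pi.single e 1 := by
  induction hx using Submodule.span_induction with
  | mem x h =>
    obtain ⟨a, b, u, v, hab, huv, rfl⟩ := h
    exact ⟨{(a, b, u, v)}, by simp [hab, huv], by simp⟩
  | zero => exact ⟨∅, by simp, by simp⟩
  | add x y _ _ hx hy =>
    obtain ⟨S, hS, rfl⟩ := hx
    obtain ⟨T, hT, rfl⟩ := hy
    refine ⟨S ∆ T, fun q hq => ?_, (sum_symmDiff_charTwo _ _ _).symm⟩
    obtain h | h := Finset.mem_symmDiff.mp hq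
    exacts [hS q h.1, hT q h.1]
  | smul c x _ hx =>
    obtain rfl | rfl : c = 0 ∨ c = 1 := by revert c; decide
    · exact ⟨∅, by simp, by simp⟩
    · simpa using hx

theorem isSumOfBoundaries_of_mem_boundarySubmodule {Z : Finset (Sym2 (V × V))}
    (hZ : ∑ e ∈ Z, Pi.single e 1 ∈ boundarySubmodule K) : IsSumOfBoundaries K Z := by
  obtain ⟨S, hS, h⟩ := exists_finset_of_mem_boundarySubmodule hZ
  refine ⟨S, hS, fun e => ?_⟩
  have he := congrFun h e
  simp only [Finset.sum_apply, Pi.single_apply, Finset.sum_ite_eq] at he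
  rw [← Finset.sum_filter, Finset.sum_const, nsmul_eq_ite_odd] at he
  split_ifs at he <;> simp_all

/-- A cocycle takes the same value on a cycle and on its projections placed on the axes. -/
theorem IsOneCycle.sum_eq_sum_axes (hK : K.Connected) {C : Finset (Sym2 (V × V))}
    (hC : IsOneCycle (K □ K) C) {F : Sym2 (V × V) → M}
    (hF : ∀ a b u v, K.Adj a b → K.Adj u v → ∑ e ∈ bdry a b u v, F e = 0) (a : V) :
    ∑ e ∈ C, F e = ∑ e ∈ rightCyc a (projX C), F e +
      ∑ e ∈ leftCyc a (projY C), F e := by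
  obtain ⟨f, hleft, hright⟩ := exists_primitive hK hF a
  rw [sum_leftCyc, sum_rightCyc, ← add_zero (∑ e ∈ C, F e), ← hC.sum_coboundary f,
    ← Finset.sum_add_distrib]
  refine sum_eq_sum_projections hC.1 ?_ ?_
  · rintro ⟨x, y⟩ hσ b
    change F s((b, x), (b, y)) + (f (b, x) + f (b, y)) = F s((a, x), (a, y))
    rw [hleft b x y hσ, ← add_assoc, ZModModule.add_self, zero_add]
  · rintro ⟨x, y⟩ hσ b
    change F s((x, b), (y, b)) + (f (x, b) + f (y, b)) = F s((x, a), (y, a))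
    rw [hright b x y hσ, ← add_assoc, ZModModule.add_self, zero_add]

theorem IsOneCycle.isSumOfBoundaries (hK : K.Connected) {C : Finset (Sym2 (V × V))}
    (hC : IsOneCycle (K □ K) C) (a : V) :
    IsSumOfBoundaries K
      (C ∆ (rightCyc a (projX C) ∆ leftCyc a (projY C))) := by
  apply isSumOfBoundaries_of_mem_boundarySubmodule
  let π := (boundarySubmodule K).mkQ
  have hF : ∀ a b u v, K.Adj a b → K.Adj u v →
      ∑ e ∈ bdry a b u v, π (Pi.single e 1) = 0 := by
    intro a b u v hab huv
    rw [← map_sum, Submodule.mkQ_apply, Submodule.Quotient.mk_eq_zero]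
    exact Submodule.subset_span ⟨a, b, u, v, hab, huv, rfl⟩
  rw [← Submodule.Quotient.mk_eq_zero, ← Submodule.mkQ_apply, map_sum, sum_symmDiff_charTwo,
    sum_symmDiff_charTwo, hC.sum_eq_sum_axes hK hF a, ZModModule.add_self]

theorem axes_sum_of_isSumOfBoundaries {a : V} {C : Finset (Sym2 (V × V))}
    {C₁ C₂ : Finset (Sym2 V)}
    (h : IsSumOfBoundaries K (C ∆ (rightCyc a C₁ ∆ leftCyc a C₂)))
    {G : Sym2 V → M} (hG : ∀ v, G s(v, v) = 0) :
    ∑ σ ∈ C₁, G σ = ∑ e ∈ C, G (e.map Prod.fst) ∧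
      ∑ σ ∈ C₂, G σ = ∑ e ∈ C, G (e.map Prod.snd) := by
  constructor
  · have hs := h.sum_eq_zero (F := fun e => G (e.map Prod.fst)) fun a b u v hab huv => by
      simp [sum_bdry hab huv, hG, ZModModule.add_self]
    rw [sum_symmDiff_charTwo, sum_symmDiff_charTwo, sum_leftCyc, sum_rightCyc,
      add_eq_zero_iff_eq_of_charTwo] at hs
    rw [hs, Finset.sum_eq_zero (s := C₂), add_zero]
    · simp [Sym2.map_map]
    · rintro ⟨x, y⟩ -
      exact hG a
  · have hs := h.sum_eq_zero (F := fun e => G (e.map Prod.snd)) fun a b u v hab huv => by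
      simp [sum_bdry hab huv, hG, ZModModule.add_self]
    rw [sum_symmDiff_charTwo, sum_symmDiff_charTwo, sum_leftCyc, sum_rightCyc,
      add_eq_zero_iff_eq_of_charTwo] at hs
    rw [hs, Finset.sum_eq_zero (s := C₁), zero_add]
    · simp [Sym2.map_map]
    · rintro ⟨x, y⟩ -
      exact hG a

end Product

/-- Künneth theorem for 1-cycles: if `K` is connected then for any 1-cycle `C`
in `K □ K` and vertex `a` of `K` there are unique 1-cycles `C₁`, `C₂` in `K`
such that `C + C₁ × a + a × C₂` is a sum of boundaries; moreover one can take
`C₁ = C_x` and `C₂ = C_y`. -/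
theorem stmt_11 {V : Type*} [Fintype V] [DecidableEq V] (K : SimpleGraph V)
    (hK : K.Connected) (a : V) (C : Finset (Sym2 (V × V)))
    (hC : IsOneCycle (K.boxProd K) C) :
    (∃! p : Finset (Sym2 V) × Finset (Sym2 V),
      IsOneCycle K p.1 ∧ IsOneCycle K p.2 ∧
      IsSumOfBoundaries K (C ∆ (rightCyc a p.1 ∆ leftCyc a p.2))) ∧
    IsOneCycle K (projX C) ∧ IsOneCycle K (projY C) ∧
    IsSumOfBoundaries K (C ∆ (rightCyc a (projX C) ∆ leftCyc a (projY C))) := by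
  have unique {p q : Finset (Sym2 V) × Finset (Sym2 V)}
      (hp : IsOneCycle K p.1 ∧ IsOneCycle K p.2 ∧
        IsSumOfBoundaries K (C ∆ (rightCyc a p.1 ∆ leftCyc a p.2)))
      (hq : IsOneCycle K q.1 ∧ IsOneCycle K q.2 ∧
        IsSumOfBoundaries K (C ∆ (rightCyc a q.1 ∆ leftCyc a q.2))) : p = q := by
    obtain ⟨hp₁, hp₂, hp⟩ := hp
    obtain ⟨hq₁, hq₂, hq⟩ := hq
    have ndiag {D : Finset (Sym2 V)} (hD : IsOneCycle K D) (e : Sym2 V) (he : e ∈ D) :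
        ¬ e.IsDiag := K.not_isDiag_of_mem_edgeSet (hD.1 e he)
    refine Prod.ext (eq_of_sum_eq (ndiag hp₁) (ndiag hq₁) fun G hG => ?_)
      (eq_of_sum_eq (ndiag hp₂) (ndiag hq₂) fun G hG => ?_)
    · rw [(axes_sum_of_isSumOfBoundaries hp hG).1, (axes_sum_of_isSumOfBoundaries hq hG).1]
    · rw [(axes_sum_of_isSumOfBoundaries hp hG).2, (axes_sum_of_isSumOfBoundaries hq hG).2]
  have h := And.intro (isOneCycle_projX hC) <|
    And.intro (isOneCycle_projY hC) (hC.isSumOfBoundaries hK a)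
  exact ⟨⟨(projX C, projY C), h, fun _ hp => unique hp h⟩, h⟩
end

section
/- Let R be a set of 4-element subsets of [n] such that every 3-element subset of [n] is contained in an even number of members of R. Then there is a set R' of 5-element subsets of [n] such that a 4-element subset B of [n] belongs to R if and only if B is contained in an odd number of members of R'. -/
open scoped Classical

/-- The cone with apex `p` over the members of `R` that avoid `p`. -/
def coneOver {α : Type*} [DecidableEq α] (p : α) (R : Finset (Finset α)) :
    Finset (Finset α) :=
  (R.filter (fun A => p ∉ A)).image (insert p)

/-- The members of the cone containing `B` correspond to the members of `R` that avoid `p`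
and contain `B.erase p`. -/
lemma card_filter_coneOver {α : Type*} [DecidableEq α] (p : α) (R : Finset (Finset α))
    (B : Finset α) :
    ((coneOver p R).filter (fun A => B ⊆ A)).card =
      (R.filter (fun A => p ∉ A ∧ B.erase p ⊆ A)).card := by
  rw [coneOver, Finset.filter_image, Finset.filter_filter]
  simp only [Finset.subset_insert_iff]
  refine Finset.card_image_of_injOn fun A hA A' hA' h => ?_
  simp only [Finset.coe_filter, Set.mem_ofPred_eq] at hA hA'
  rw [← Finset.erase_insert hA.2.1, ← Finset.erase_insert hA'.2.1]
  exact congrArg (fun S => S.erase p) h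

/-- A uniform family in which every set of size `k` lies in an even number of members is the
mod 2 boundary of its cone: simplices are acyclic over the field with two elements. -/
lemma mem_iff_odd_card_filter_coneOver {α : Type*} [DecidableEq α] {k : ℕ} (p : α)
    {R : Finset (Finset α)} (hR : ∀ A ∈ R, A.card = k + 1)
    (hrel : ∀ C : Finset α, C.card = k → Even ((R.filter (fun A => C ⊆ A)).card))
    {B : Finset α} (hB : B.card = k + 1) :
    B ∈ R ↔ Odd (((coneOver p R).filter (fun A => B ⊆ A)).card) := by
  have eq_of_subset {A : Finset α} (hA : A ∈ R) (h : B ⊆ A) : A = B :=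
    (Finset.eq_of_subset_of_card_le h (by rw [hR A hA, hB])).symm
  rw [card_filter_coneOver]
  by_cases hp : p ∈ B
  · have hC : (B.erase p).card = k := by rw [Finset.card_erase_of_mem hp, hB]; rfl
    have hsplit := Finset.card_filter_add_card_filter_not
      (s := R.filter (fun A => B.erase p ⊆ A)) (fun A => p ∈ A)
    have hmem : (R.filter (fun A => B.erase p ⊆ A)).filter (fun A => p ∈ A) =
        R.filter (fun A => A = B) := by
      ext A
      simp only [Finset.mem_filter]
      constructor
      · rintro ⟨⟨hA, hs⟩, hpA⟩
        refine ⟨hA, eq_of_subset hA ?_⟩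
        rwa [← Finset.subset_insert_iff, Finset.insert_eq_of_mem hpA] at hs
      · rintro ⟨hA, rfl⟩
        exact ⟨⟨hA, Finset.erase_subset _ _⟩, hp⟩
    have hnot : (R.filter (fun A => B.erase p ⊆ A)).filter (fun A => p ∉ A) =
        R.filter (fun A => p ∉ A ∧ B.erase p ⊆ A) := by
      rw [Finset.filter_filter]
      simp only [and_comm]
    have heven := hrel _ hC
    rw [← hsplit, hmem, hnot, Finset.filter_eq', Nat.even_add'] at heven
    rw [← heven]
    by_cases hBR : B ∈ R <;> simp [hBR]
  · have hfilter : R.filter (fun A => p ∉ A ∧ B.erase p ⊆ A) = R.filter (fun A => A = B) := by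
      rw [Finset.erase_eq_of_notMem hp]
      refine Finset.filter_congr fun A hA => ⟨fun h => eq_of_subset hA h.2, ?_⟩
      rintro rfl
      exact ⟨hp, subset_rfl⟩
    rw [hfilter, Finset.filter_eq']
    by_cases hBR : B ∈ R <;> simp [hBR]

/-- If `R` is a set of 4-element subsets of `[n]` such that every 3-element
subset of `[n]` is contained in an even number of members of `R`, then there is
a set `R'` of 5-element subsets of `[n]` such that a 4-element subset `B` of
`[n]` belongs to `R` if and only if `B` is contained in an odd number of
members of `R'`. -/
theorem stmt_14 (n : ℕ) (R : Finset (Finset (Fin n)))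
    (hR : ∀ A ∈ R, A.card = 4)
    (hrel : ∀ B : Finset (Fin n), B.card = 3 →
      Even ((R.filter (fun A => B ⊆ A)).card)) :
    ∃ R' : Finset (Finset (Fin n)),
      (∀ A ∈ R', A.card = 5) ∧
      ∀ B : Finset (Fin n), B.card = 4 →
        (B ∈ R ↔ Odd ((R'.filter (fun A => B ⊆ A)).card)) := by
  rcases n with _ | n
  · refine ⟨∅, by simp, fun B hB => ?_⟩
    simp [Finset.eq_empty_of_isEmpty B] at hB
  · refine ⟨coneOver 0 R, fun A hA => ?_, fun B hB =>
      mem_iff_odd_card_filter_coneOver 0 hR hrel hB⟩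
    obtain ⟨A', hA', rfl⟩ := Finset.mem_image.mp hA
    rw [Finset.mem_filter] at hA'
    rw [Finset.card_insert_of_notMem hA'.2, hR A' hA'.1]
end

section
/- Let C be a rook cycle in [n]^ℓ, i.e., a subset of [n]^ℓ containing an even number of points of every line. If C contains no element of [n−1]^ℓ (no point all of whose coordinates are less than n), then C is empty. -/
open scoped Classical

/-- A rook cycle in `[n]^ℓ` is a subset containing an even number of points of
every line (a line is obtained by fixing all coordinates except one). If a rook
cycle contains no point all of whose coordinates are less than `n` (i.e., no
element of `[n-1]^ℓ`), then it is empty. -/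
theorem stmt_15 (n ℓ : ℕ) (hn : 1 ≤ n) (C : Finset (Fin ℓ → Fin n))
    (hcyc : ∀ (i : Fin ℓ) (x : Fin ℓ → Fin n),
      Even ((C.filter (fun y => ∀ j, j ≠ i → y j = x j)).card))
    (h : ∀ x ∈ C, ∃ i : Fin ℓ, x i = (⟨n - 1, by omega⟩ : Fin n)) :
    C = ∅ := by
  by_contra hne
  set top : Fin n := ⟨n - 1, by omega⟩ with htop
  -- Take a point of `C` with the fewest coordinates equal to the top value.
  obtain ⟨x, hxC, hmin⟩ := C.exists_min_image
    (fun y => (Finset.univ.filter (fun j => y j = top)).card)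
    (Finset.nonempty_iff_ne_empty.mpr hne)
  obtain ⟨i, hi⟩ := h x hxC
  -- By parity, the line through `x` in direction `i` meets `C` in another point.
  have hx : x ∈ C.filter (fun y => ∀ j, j ≠ i → y j = x j) := by simp [hxC]
  have hcard : 1 < (C.filter (fun y => ∀ j, j ≠ i → y j = x j)).card := by
    have hpos := Finset.card_pos.mpr ⟨x, hx⟩
    obtain ⟨k, hk⟩ := hcyc i x
    omega
  obtain ⟨y, hy, hyx⟩ := Finset.exists_mem_ne hcard x
  obtain ⟨hyC, hline⟩ := Finset.mem_filter.mp hy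
  have hyi : y i ≠ top := by
    intro hyi
    apply hyx
    funext j
    by_cases hj : j = i
    · rw [hj, hyi, hi]
    · exact hline j hj
  refine (hmin y hyC).not_gt (Finset.card_lt_card ?_)
  refine Finset.ssubset_iff_of_subset (fun j hj => ?_) |>.mpr ⟨i, by simp [hi], by simp [hyi]⟩
  have hjtop : y j = top := (Finset.mem_filter.mp hj).2
  have hji : j ≠ i := fun hji => hyi (hji ▸ hjtop)
  simpa [hline j hji] using hjtop
end

section
/- Every rook cycle in [n]^ℓ is a sum (symmetric difference) of parallelepipeds. Concretely, any rook cycle C equals the sum of the parallelepipeds P(a) = {n,a₁}×…×{n,a_ℓ} over all points a ∈ C ∩ [n−1]^ℓ. -/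
open scoped Classical

/-- A `ZMod 2`-valued function whose sum over every line vanishes is recovered from its values at
the points whose coordinates in `T` avoid `m`. -/
theorem sum_filter_avoiding_eq {ι α : Type*} [Fintype ι] [Fintype α] (f : (ι → α) → ZMod 2) (m : α)
    (hf : ∀ i x, ∑ v, f (Function.update x i v) = 0) (T : Finset ι) (x : ι → α) :
    ∑ a with (∀ i ∈ T, a i ≠ m ∧ (x i = a i ∨ x i = m)) ∧ ∀ i ∉ T, a i = x i, f a = f x := by
  induction T using Finset.induction_on generalizing x with
  | empty => simp [← funext_iff, Finset.sum_filter]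
  | insert i T hi ih =>
    by_cases hx : x i = m
    · have hline : ∑ v with v ≠ m, f (Function.update x i v) = f x := by
        have h := hf i x
        rw [← Finset.sum_filter_add_sum_filter_not _ (· ≠ m)] at h
        have hm : Function.update x i m = x := by rw [← hx, Function.update_eq_self]
        have hlast : ∑ v with ¬ v ≠ m, f (Function.update x i v) = f x := by
          simp [Finset.sum_filter, hm]
        rw [hlast] at h
        exact CharTwo.add_eq_zero.1 h
      rw [← hline, ← Finset.sum_fiberwise_of_maps_to (g := fun a => a i) (t := {v | v ≠ m})]
      · refine Finset.sum_congr rfl fun v hv => ?_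
        rw [← ih (Function.update x i v), Finset.filter_filter]
        refine Finset.sum_congr (Finset.filter_congr fun a _ => ?_) fun _ _ => rfl
        have hv : v ≠ m := by simpa using hv
        constructor
        · rintro ⟨⟨h₁, h₂⟩, h₃⟩
          refine ⟨fun j hj => ?_, fun j hj => ?_⟩
          · have hji : j ≠ i := fun h => hi (h ▸ hj)
            simpa [hji] using h₁ j (Finset.mem_insert_of_mem hj)
          · by_cases hji : j = i
            · subst hji; simpa using h₃
            · simpa [hji] using h₂ j (by simp [hji, hj])
        · rintro ⟨h₁, h₂⟩
          have h₃ : a i = v := by simpa using h₂ i hi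
          refine ⟨⟨fun j hj => ?_, fun j hj => ?_⟩, h₃⟩
          · by_cases hji : j = i
            · subst hji; exact ⟨h₃ ▸ hv, Or.inr hx⟩
            · simpa [hji] using h₁ j ((Finset.mem_insert.1 hj).resolve_left hji)
          · rw [Finset.mem_insert, not_or] at hj
            simpa [hj.1] using h₂ j hj.2
      · intro a ha
        simpa using ((Finset.mem_filter.1 ha).2.1 i (Finset.mem_insert_self i T)).1
    · rw [← ih x]
      refine Finset.sum_congr (Finset.filter_congr fun a _ => ?_) fun _ _ => rfl
      grind

/-- A finite set meeting every line in an even number of points contains `x` iff `x` lies in an odd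
number of the boxes `∏ i, {m, a i}` over the points `a` of the set avoiding `m`. -/
theorem mem_iff_odd_card_avoiding {ι α : Type*} [Fintype ι] [Fintype α] (C : Finset (ι → α)) (m : α)
    (hC : ∀ (i : ι) (x : ι → α), Even (C.filter (fun y => ∀ j, j ≠ i → y j = x j)).card) (x : ι → α) :
    x ∈ C ↔ Odd (C.filter (fun a => (∀ i, a i ≠ m) ∧ ∀ i, x i = a i ∨ x i = m)).card := by
  have hline : ∀ i x, ∑ v, (if Function.update x i v ∈ C then 1 else 0 : ZMod 2) = 0 := by
    intro i x
    rw [Finset.sum_boole, ZMod.natCast_eq_zero_iff_even]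
    convert hC i x using 1
    refine Finset.card_bij (fun v _ => Function.update x i v) ?_ ?_ ?_
    · intro v hv
      simp only [Finset.mem_filter, Finset.mem_univ, true_and] at hv ⊢
      exact ⟨hv, fun j hj => Function.update_of_ne hj _ _⟩
    · intro v _ w _ h
      exact Function.update_injective x i h
    · intro y hy
      obtain ⟨hyC, hy⟩ := Finset.mem_filter.1 hy
      have hxy : Function.update x i (y i) = y :=
        Function.update_eq_iff.2 ⟨rfl, fun j hj => (hy j hj).symm⟩
      exact ⟨y i, by simpa [hxy] using hyC, hxy⟩
  have h := sum_filter_avoiding_eq (fun y => if y ∈ C then 1 else 0) m hline Finset.univ x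
  rw [Finset.sum_boole, Finset.filter_filter] at h
  rw [← ZMod.natCast_eq_one_iff_odd]
  have hset : C.filter (fun a => (∀ i, a i ≠ m) ∧ ∀ i, x i = a i ∨ x i = m) =
      Finset.univ.filter (fun a => ((∀ i ∈ Finset.univ, a i ≠ m ∧ (x i = a i ∨ x i = m)) ∧
        ∀ i ∉ Finset.univ, a i = x i) ∧ a ∈ C) := by
    ext a
    simp [forall_and, and_comm]
  rw [hset, h]
  split_ifs with hx <;> simp [hx]

/-- Every rook cycle in `[n]^ℓ` is a sum (mod 2) of parallelepipeds
`P₁ × … × P_ℓ` with each `P_i` a 2-element subset of `[n]`; concretely, a rook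
cycle `C` equals the sum of the parallelepipeds `P(a) = {n,a₁} × … × {n,a_ℓ}`
over all points `a ∈ C ∩ [n-1]^ℓ` (a point belongs to the sum iff it belongs
to an odd number of summands). -/
theorem stmt_16 (n ℓ : ℕ) (hn : 1 ≤ n) (C : Finset (Fin ℓ → Fin n))
    (hcyc : ∀ (i : Fin ℓ) (x : Fin ℓ → Fin n),
      Even ((C.filter (fun y => ∀ j, j ≠ i → y j = x j)).card)) :
    (∃ S : Finset (Fin ℓ → Finset (Fin n)),
      (∀ P ∈ S, ∀ i, (P i).card = 2) ∧
      ∀ x : Fin ℓ → Fin n, x ∈ C ↔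
        Odd ((S.filter (fun P => ∀ i, x i ∈ P i)).card)) ∧
    (∀ x : Fin ℓ → Fin n, x ∈ C ↔
      Odd ((C.filter (fun a =>
        (∀ i, a i ≠ (⟨n - 1, by omega⟩ : Fin n)) ∧
        (∀ i, x i = a i ∨ x i = (⟨n - 1, by omega⟩ : Fin n)))).card)) := by
  have hodd := mem_iff_odd_card_avoiding C (⟨n - 1, by omega⟩ : Fin n)
    fun i x => by convert hcyc i x
  refine ⟨?_, fun x => by convert hodd x⟩
  generalize (⟨n - 1, by omega⟩ : Fin n) = m at hodd
  refine ⟨(C.filter fun a => ∀ i, a i ≠ m).image fun a i => {a i, m}, ?_, fun x => ?_⟩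
  · simp only [Finset.mem_image, Finset.mem_filter]
    rintro _ ⟨a, ⟨_, ha⟩, rfl⟩ i
    exact Finset.card_pair (ha i)
  · rw [hodd x, Finset.filter_image, Finset.card_image_of_injOn]
    · simp [Finset.filter_filter]
    · intro a ha b hb hab
      simp only [Finset.coe_filter, Finset.mem_filter, Set.mem_ofPred_eq] at ha
      funext i
      have hmem : a i ∈ ({b i, m} : Finset (Fin n)) := by
        have h : ({a i, m} : Finset (Fin n)) = {b i, m} := congrFun hab i
        simp [← h]
      simpa [ha.1.2 i] using hmem
end

section
/- Let K be a finite connected graph with V vertices and E edges. Then the number of cellular 2-cycles in K² = K×K equals 2^((E−V+1)²). -/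
open scoped Classical

/-- A cellular 2-cycle in `K² = K × K`: a set `C` of ordered pairs of edges of
`K` such that for every vertex `a` and edge `β` of `K`, the number of edges `α`
containing `a` with `(α, β) ∈ C` is even, and the number of edges `α`
containing `a` with `(β, α) ∈ C` is even. -/
def IsCell2Cycle {V : Type*} [Fintype V] (K : SimpleGraph V)
    (C : Finset (Sym2 V × Sym2 V)) : Prop :=
  (∀ p ∈ C, p.1 ∈ K.edgeSet ∧ p.2 ∈ K.edgeSet) ∧
  ∀ (a : V) (β : Sym2 V),
    Even ((C.filter (fun p => a ∈ p.1 ∧ p.2 = β)).card) ∧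
    Even ((C.filter (fun p => p.1 = β ∧ a ∈ p.2)).card)

/-- The vertex-edge incidence matrix of `K` over `ZMod 2`, with columns indexed by the edges. -/
noncomputable def edgeIncMatrix {V : Type*} (K : SimpleGraph V) :
    Matrix V K.edgeSet (ZMod 2) :=
  Matrix.of fun a e => if a ∈ (e : Sym2 V) then 1 else 0

/-- The space of 1-cycles of `K` over `ZMod 2`. -/
noncomputable abbrev cycleSpace {V : Type*} [Fintype V] (K : SimpleGraph V) :
    Submodule (ZMod 2) (K.edgeSet → ZMod 2) :=
  LinearMap.ker (edgeIncMatrix K).mulVecLin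

lemma edgeIncMatrix_mulVec_apply {V : Type*} [Fintype V] (K : SimpleGraph V)
    (f : K.edgeSet → ZMod 2) (a : V) :
    (edgeIncMatrix K).mulVec f a = ∑ e : K.edgeSet, if a ∈ (e : Sym2 V) then f e else 0 := by
  simp [Matrix.mulVec, dotProduct, edgeIncMatrix]

lemma edgeIncMatrix_transpose_mulVec {V : Type*} [Fintype V] (K : SimpleGraph V)
    (x : V → ZMod 2) {u v : V} (h : K.Adj u v) :
    (edgeIncMatrix K).transpose.mulVec x ⟨s(u, v), h⟩ = x u + x v := by
  have h1 : ∀ a, (if a = u ∨ a = v then x a else 0) =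
      (if a = u then x a else 0) + (if a = v then x a else 0) := by
    intro a
    have := h.ne
    by_cases h1 : a = u <;> by_cases h2 : a = v <;> simp_all
  simp [Matrix.mulVec, dotProduct, edgeIncMatrix, h1, Finset.sum_add_distrib]

lemma ker_edgeIncMatrix_transpose {V : Type*} [Fintype V] (K : SimpleGraph V)
    (hK : K.Connected) :
    LinearMap.ker (edgeIncMatrix K).transpose.mulVecLin =
      Submodule.span (ZMod 2) {(1 : V → ZMod 2)} := by
  ext x
  rw [Submodule.mem_span_singleton, LinearMap.mem_ker, Matrix.mulVecLin_apply]
  constructor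
  · intro hx
    have hadj : ∀ u v, K.Adj u v → x u = x v := by
      intro u v h
      have h1 := congrFun hx ⟨s(u, v), h⟩
      rw [edgeIncMatrix_transpose_mulVec K x h] at h1
      exact CharTwo.add_eq_zero.mp h1
    have hwalk : ∀ u v, K.Walk u v → x u = x v := by
      intro u v p
      induction p with
      | nil => rfl
      | cons h _ ih => exact (hadj _ _ h).trans ih
    obtain ⟨v⟩ := hK.nonempty
    refine ⟨x v, funext fun w => ?_⟩
    obtain ⟨p⟩ := hK.preconnected v w
    simpa using hwalk v w p
  · rintro ⟨c, rfl⟩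
    funext ⟨e, he⟩
    induction e with
    | h u v =>
      rw [edgeIncMatrix_transpose_mulVec K _ he]
      simp [CharTwo.add_self_eq_zero]

lemma finrank_cycleSpace {V : Type*} [Fintype V] (K : SimpleGraph V) (hK : K.Connected) :
    Module.finrank (ZMod 2) (cycleSpace K) = Fintype.card K.edgeSet + 1 - Fintype.card V := by
  have h1 := LinearMap.finrank_range_add_finrank_ker (edgeIncMatrix K).mulVecLin
  have h2 := LinearMap.finrank_range_add_finrank_ker (edgeIncMatrix K).transpose.mulVecLin
  have h3 := (edgeIncMatrix K).rank_transpose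
  have : Nonempty V := hK.nonempty
  rw [ker_edgeIncMatrix_transpose K hK, finrank_span_singleton one_ne_zero] at h2
  rw [Module.finrank_fintype_fun_eq_card] at h1 h2
  unfold Matrix.rank at h3
  change Module.finrank (ZMod 2) (LinearMap.ker (edgeIncMatrix K).mulVecLin) = _
  omega

/-- Square arrays of which all rows and all columns lie in a subspace `Z`. -/
def rowColSpace {ι F : Type*} [Field F] (Z : Submodule F (ι → F)) : Set (ι → ι → F) :=
  {f | (∀ i, f i ∈ Z) ∧ ∀ j, (fun i => f i j) ∈ Z}

lemma coord_comp_mem {ι F κ : Type*} [Fintype ι] [Field F] {Z : Submodule F (ι → F)}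
    (b : Module.Basis κ F Z) {f : ι → ι → F} (hf : f ∈ rowColSpace Z) (k : κ) :
    (fun i => b.repr ⟨f i, hf.1 i⟩ k) ∈ Z := by
  obtain ⟨φ, hφ⟩ := LinearMap.exists_extend (b.coord k)
  have h : (fun i => b.repr ⟨f i, hf.1 i⟩ k) =
      ∑ j, φ (Pi.single j 1) • fun i => f i j := by
    funext i
    have h1 : b.repr ⟨f i, hf.1 i⟩ k = φ (f i) :=
      (LinearMap.congr_fun hφ ⟨f i, hf.1 i⟩).symm
    rw [h1, ← LinearMap.sum_single_apply (fun _ => F) (f i), map_sum, Finset.sum_apply]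
    refine Finset.sum_congr rfl fun j _ => ?_
    rw [← mul_one (f i j), ← smul_eq_mul, Pi.single_smul, map_smul]
    simp [mul_comm]
  rw [h]
  exact Submodule.sum_mem _ fun j _ => Z.smul_mem _ (hf.2 j)

/-- Expanding each row in a basis of `Z` identifies `rowColSpace Z` with families in `Z`. -/
noncomputable def rowColSpaceEquiv {ι F κ : Type*} [Fintype ι] [Fintype κ] [Field F]
    {Z : Submodule F (ι → F)} (b : Module.Basis κ F Z) : rowColSpace Z ≃ (κ → Z) where
  toFun f k := ⟨fun i => b.repr ⟨f.1 i, f.2.1 i⟩ k, coord_comp_mem b f.2 k⟩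
  invFun h := ⟨fun i => (b.equivFun.symm fun k => (h k).1 i : Z), fun i => SetLike.coe_mem _, fun j => by
    have h1 : (fun i => (b.equivFun.symm fun k => (h k).1 i : Z).1 j) =
        ∑ k, (b k).1 j • (h k).1 := by
      funext i
      simp [Module.Basis.equivFun_symm_apply, Finset.sum_apply, mul_comm]
    rw [h1]
    exact Submodule.sum_mem _ fun k _ => Z.smul_mem _ (h k).2⟩
  left_inv f := by
    apply Subtype.ext
    funext i
    exact congrArg Subtype.val (b.equivFun.symm_apply_apply ⟨f.1 i, f.2.1 i⟩)
  right_inv h := by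
    funext k
    apply Subtype.ext
    funext i
    exact congrFun (b.equivFun.apply_symm_apply fun k => (h k).1 i) k

lemma card_rowColSpace {ι F : Type*} [Fintype ι] [Field F] [Finite F]
    (Z : Submodule F (ι → F)) :
    Nat.card (rowColSpace Z) = Nat.card F ^ Module.finrank F Z ^ 2 := by
  rw [Nat.card_congr (rowColSpaceEquiv (Module.finBasis F Z)), Nat.card_pi,
    Finset.prod_const, Finset.card_univ, Fintype.card_fin,
    Module.natCard_eq_pow_finrank (K := F) (V := Z), ← pow_mul, sq]

lemma mem_cycleSpace_indicator_iff {V : Type*} [Fintype V] (K : SimpleGraph V)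
    (P : Sym2 V → Prop) [DecidablePred P] :
    (fun e : K.edgeSet => if P e then (1 : ZMod 2) else 0) ∈ cycleSpace K ↔
      ∀ a : V, Even (Finset.univ.filter fun e : K.edgeSet => a ∈ (e : Sym2 V) ∧ P e).card := by
  rw [LinearMap.mem_ker, Matrix.mulVecLin_apply, funext_iff]
  refine forall_congr' fun a => ?_
  rw [edgeIncMatrix_mulVec_apply, ← ZMod.natCast_eq_zero_iff_even, Finset.card_filter]
  simp [ite_and]

lemma card_filter_left {V : Type*} [Fintype V] (K : SimpleGraph V)
    {C : Finset (Sym2 V × Sym2 V)} (hC : ∀ p ∈ C, p.1 ∈ K.edgeSet ∧ p.2 ∈ K.edgeSet)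
    (a : V) (β : Sym2 V) :
    (C.filter fun p => a ∈ p.1 ∧ p.2 = β).card =
      (Finset.univ.filter fun e : K.edgeSet => a ∈ (e : Sym2 V) ∧ ((e : Sym2 V), β) ∈ C).card := by
  symm
  refine Finset.card_bij (fun e _ => ((e : Sym2 V), β)) ?_ ?_ ?_
  · simp +contextual
  · intro e _ e' _ h
    exact Subtype.ext (congrArg Prod.fst h)
  · rintro ⟨α, γ⟩ h
    obtain ⟨hm, ha, rfl⟩ := Finset.mem_filter.mp h
    exact ⟨⟨α, (hC _ hm).1⟩, by simpa using ⟨ha, hm⟩, rfl⟩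

lemma card_filter_right {V : Type*} [Fintype V] (K : SimpleGraph V)
    {C : Finset (Sym2 V × Sym2 V)} (hC : ∀ p ∈ C, p.1 ∈ K.edgeSet ∧ p.2 ∈ K.edgeSet)
    (a : V) (β : Sym2 V) :
    (C.filter fun p => p.1 = β ∧ a ∈ p.2).card =
      (Finset.univ.filter fun e : K.edgeSet => a ∈ (e : Sym2 V) ∧ (β, (e : Sym2 V)) ∈ C).card := by
  symm
  refine Finset.card_bij (fun e _ => (β, (e : Sym2 V))) ?_ ?_ ?_
  · simp +contextual
  · intro e _ e' _ h
    exact Subtype.ext (congrArg Prod.snd h)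
  · rintro ⟨γ, α⟩ h
    obtain ⟨hm, rfl, ha⟩ := Finset.mem_filter.mp h
    exact ⟨⟨α, (hC _ hm).2⟩, by simpa using ⟨ha, hm⟩, rfl⟩

/-- The indicator of a set of cells, as an array indexed by the edges. -/
noncomputable def cellIndicator {V : Type*} (K : SimpleGraph V) (C : Finset (Sym2 V × Sym2 V)) :
    K.edgeSet → K.edgeSet → ZMod 2 :=
  fun α β => if ((α : Sym2 V), (β : Sym2 V)) ∈ C then 1 else 0

lemma isCell2Cycle_iff {V : Type*} [Fintype V] (K : SimpleGraph V)
    (C : Finset (Sym2 V × Sym2 V)) :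
    IsCell2Cycle K C ↔ (∀ p ∈ C, p.1 ∈ K.edgeSet ∧ p.2 ∈ K.edgeSet) ∧
      cellIndicator K C ∈ rowColSpace (cycleSpace K) := by
  refine and_congr_right fun hC => ?_
  have hrow (α : K.edgeSet) := mem_cycleSpace_indicator_iff K fun β => ((α : Sym2 V), β) ∈ C
  have hcol (β : K.edgeSet) := mem_cycleSpace_indicator_iff K fun α => (α, (β : Sym2 V)) ∈ C
  constructor
  · intro h
    exact ⟨fun α => (hrow α).2 fun a => card_filter_right K hC a α ▸ (h a α).2,
      fun β => (hcol β).2 fun a => card_filter_left K hC a β ▸ (h a β).1⟩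
  · rintro ⟨h1, h2⟩ a β
    by_cases hβ : β ∈ K.edgeSet
    · rw [card_filter_left K hC, card_filter_right K hC]
      exact ⟨(hcol ⟨β, hβ⟩).1 (h2 ⟨β, hβ⟩) a, (hrow ⟨β, hβ⟩).1 (h1 ⟨β, hβ⟩) a⟩
    · rw [Finset.filter_eq_empty_iff.2, Finset.filter_eq_empty_iff.2]
      · simp
      · rintro p hp ⟨rfl, -⟩
        exact hβ (hC p hp).1
      · rintro p hp ⟨-, rfl⟩
        exact hβ (hC p hp).2

lemma eq_of_cellIndicator_eq {V : Type*} (K : SimpleGraph V) {C D : Finset (Sym2 V × Sym2 V)}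
    (hC : ∀ p ∈ C, p.1 ∈ K.edgeSet ∧ p.2 ∈ K.edgeSet)
    (hD : ∀ p ∈ D, p.1 ∈ K.edgeSet ∧ p.2 ∈ K.edgeSet)
    (h : cellIndicator K C = cellIndicator K D) : C = D := by
  ext ⟨α, β⟩
  by_cases hαβ : α ∈ K.edgeSet ∧ β ∈ K.edgeSet
  · have h1 := congrFun (congrFun h ⟨α, hαβ.1⟩) ⟨β, hαβ.2⟩
    simp only [cellIndicator] at h1
    by_cases hc : (α, β) ∈ C <;> by_cases hd : (α, β) ∈ D <;> simp_all
  · exact ⟨fun hc => absurd (hC _ hc) hαβ, fun hd => absurd (hD _ hd) hαβ⟩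

lemma exists_cellIndicator_eq {V : Type*} [Fintype V] (K : SimpleGraph V)
    (f : K.edgeSet → K.edgeSet → ZMod 2) :
    ∃ C : Finset (Sym2 V × Sym2 V),
      (∀ p ∈ C, p.1 ∈ K.edgeSet ∧ p.2 ∈ K.edgeSet) ∧ cellIndicator K C = f := by
  refine ⟨Finset.univ.filter fun p => ∃ (h1 : p.1 ∈ K.edgeSet) (h2 : p.2 ∈ K.edgeSet),
    f ⟨p.1, h1⟩ ⟨p.2, h2⟩ = 1, ?_, ?_⟩
  · intro p hp
    obtain ⟨-, h1, h2, -⟩ := Finset.mem_filter.mp hp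
    exact ⟨h1, h2⟩
  · funext ⟨α, hα⟩ ⟨β, hβ⟩
    have h01 : ∀ x : ZMod 2, (if x = 1 then 1 else 0) = x := by decide
    simp only [cellIndicator, Finset.mem_filter, Finset.mem_univ, true_and, hα, hβ,
      exists_true_left]
    convert h01 (f ⟨α, hα⟩ ⟨β, hβ⟩)

/-- For a finite connected graph `K` with `V` vertices and `E` edges, the
number of cellular 2-cycles in `K²` equals `2^((E - V + 1)²)`. (Since
`E ≥ V - 1` for a connected graph, `E + 1 - V` equals `E - V + 1`.) -/
theorem stmt_18 {V : Type*} [Fintype V] (K : SimpleGraph V) [DecidableRel K.Adj]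
    (hK : K.Connected) :
    ((Finset.univ : Finset (Finset (Sym2 V × Sym2 V))).filter
      (fun C => IsCell2Cycle K C)).card
      = 2 ^ ((K.edgeFinset.card + 1 - Fintype.card V) ^ 2) := by
  have hcard : ((Finset.univ : Finset (Finset (Sym2 V × Sym2 V))).filter
      (fun C => IsCell2Cycle K C)).card = Nat.card (rowColSpace (cycleSpace K)) := by
    rw [Nat.card_eq_fintype_card, ← Set.toFinset_card]
    refine Finset.card_bij (fun C _ => cellIndicator K C) ?_ ?_ ?_
    · intro C hC
      exact Set.mem_toFinset.2 ((isCell2Cycle_iff K C).1 (Finset.mem_filter.mp hC).2).2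
    · intro C hC D hD h
      exact eq_of_cellIndicator_eq K (Finset.mem_filter.mp hC).2.1 (Finset.mem_filter.mp hD).2.1 h
    · intro f hf
      obtain ⟨C, hC, rfl⟩ := exists_cellIndicator_eq K f
      exact ⟨C, Finset.mem_filter.2 ⟨Finset.mem_univ _,
        (isCell2Cycle_iff K C).2 ⟨hC, Set.mem_toFinset.1 hf⟩⟩, rfl⟩
  rw [hcard, card_rowColSpace, finrank_cycleSpace K hK, Nat.card_zmod,
    SimpleGraph.edgeFinset_card]
  congr!
end

section
/- (Künneth theorem for 2-cycles) Let K be a finite graph and let C₁,…,C_q be a base of the set H₁(K) of all 1-cycles in K (i.e., every 1-cycle has a unique representation as a sum of some of the C_i). Then the products C_i×C_j, i,j ∈ [q], form a base of the set H₂(K²) of all cellular 2-cycles in K²; i.e., every cellular 2-cycle in K² has a unique representation as a sum of some of the C_i×C_j. -/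
open scoped Classical

open Matrix

/-- The characteristic vector modulo 2 of a finite set. -/
noncomputable def charVec {α : Type*} (S : Finset α) : α → ZMod 2 :=
  fun a => if a ∈ S then 1 else 0

theorem charVec_injective {α : Type*} : Function.Injective (charVec (α := α)) := by
  intro S T h
  ext a
  have ha := congrFun h a
  simp only [charVec] at ha
  by_cases h₁ : a ∈ S <;> by_cases h₂ : a ∈ T <;> simp_all

theorem charVec_surjective {α : Type*} [Fintype α] :
    Function.Surjective (charVec (α := α)) := by
  intro f
  refine ⟨Finset.univ.filter (fun a => f a = 1), funext fun a => ?_⟩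
  simp only [charVec, Finset.mem_filter, Finset.mem_univ, true_and]
  generalize f a = x
  revert x
  decide

/-- Membership in a mod 2 sum, expressed through characteristic vectors. -/
theorem mem_iff_odd_card_filter_iff {α ι : Type*} [Fintype ι] (C : Finset α) (S : Finset ι)
    (a : α) (P : ι → Prop) [DecidablePred P] :
    (a ∈ C ↔ Odd (S.filter P).card) ↔
      charVec C a = ∑ i, (if P i then 1 else 0) * charVec S i := by
  have hsum : ∑ i, (if P i then (1 : ZMod 2) else 0) * charVec S i = ((S.filter P).card : ℕ) := by
    rw [Finset.natCast_card_filter, ← Finset.sum_subset (Finset.subset_univ S)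
      fun i _ hi => by simp [charVec, hi]]
    exact Finset.sum_congr rfl fun i hi => by simp [charVec, hi]
  rw [hsum, ← ZMod.natCast_eq_one_iff_odd]
  generalize ((S.filter P).card : ZMod 2) = x
  by_cases h : a ∈ C <;> simp only [charVec, h, if_true, if_false] <;> revert x <;> decide

/-- A matrix with trivial kernel over a field has a left inverse. -/
theorem exists_left_inverse_of_mulVec_injective {F m n : Type*} [Field F] [Fintype m] [Fintype n]
    (B : Matrix m n F) (hB : Function.Injective B.mulVec) : ∃ A : Matrix n m F, A * B = 1 := by
  obtain ⟨g, hg⟩ := LinearMap.exists_leftInverse_of_injective (Matrix.toLin' B)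
    (LinearMap.ker_eq_bot.2 hB)
  refine ⟨LinearMap.toMatrix' g, ?_⟩
  rw [← LinearMap.toMatrix'_toLin' B, ← LinearMap.toMatrix'_comp, hg, LinearMap.toMatrix'_id]

/-- If `B` has trivial kernel and all rows and columns of `d` lie in the range of `B`, then
`d` factors uniquely as `B * M * Bᵀ`. -/
theorem existsUnique_eq_mul_mul_transpose {F m n : Type*} [Field F] [Fintype m] [Fintype n]
    (B : Matrix m n F) (hB : Function.Injective B.mulVec) (d : Matrix m m F)
    (hcol : ∀ y, ∃ s, (fun x => d x y) = B *ᵥ s) (hrow : ∀ x, ∃ s, d x = B *ᵥ s) :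
    ∃! M : Matrix n n F, d = B * M * Bᵀ := by
  obtain ⟨A, hA⟩ := exists_left_inverse_of_mulVec_injective B hB
  choose s hs using hcol
  choose t ht using hrow
  have hd₁ : d = B * (Matrix.of s)ᵀ := by
    ext x y
    exact congrFun (hs y) x
  have hd₂ : d = Matrix.of t * Bᵀ := by
    ext x y
    rw [ht x]
    simp [Matrix.mulVec, dotProduct, Matrix.mul_apply, mul_comm]
  have hA' : Bᵀ * Aᵀ = 1 := by rw [← Matrix.transpose_mul, hA, Matrix.transpose_one]
  refine ⟨A * d * Aᵀ, ?_, fun M hM => ?_⟩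
  · have h₁ : B * (A * d) = d := by
      rw [hd₁, ← Matrix.mul_assoc A, hA, Matrix.one_mul]
    have h₂ : d * Aᵀ * Bᵀ = d := by
      rw [hd₂, Matrix.mul_assoc _ Bᵀ, hA', Matrix.mul_one]
    change d = B * (A * d * Aᵀ) * Bᵀ
    rw [← Matrix.mul_assoc B, h₁, h₂]
  · have h₃ : A * (B * M * Bᵀ) * Aᵀ = (A * B) * M * (Bᵀ * Aᵀ) := by
      simp only [Matrix.mul_assoc]
    rw [hM, h₃, hA, hA', Matrix.one_mul, Matrix.mul_one]

/-- The set of first coordinates of the pairs of a cellular 2-cycle with a fixed second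
coordinate is a 1-cycle. -/
theorem IsCell2Cycle.isOneCycle_column {V : Type*} [Fintype V] {K : SimpleGraph V}
    {D : Finset (Sym2 V × Sym2 V)} (hD : IsCell2Cycle K D) (β : Sym2 V) :
    IsOneCycle K (Finset.univ.filter (fun e => (e, β) ∈ D)) := by
  refine ⟨fun e he => (hD.1 (e, β) (by simpa using he)).1, fun v => ?_⟩
  convert (hD.2 v β).1 using 1
  refine Finset.card_bij (fun e _ => (e, β)) ?_ ?_ ?_
  · intro e he
    simpa using he
  · intro e _ e' _ h
    exact (Prod.ext_iff.1 h).1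
  · rintro ⟨e, f⟩ h
    simp only [Finset.mem_filter] at h
    obtain ⟨h₁, h₂, rfl⟩ := h
    exact ⟨e, by simp [h₁, h₂], rfl⟩

/-- The set of second coordinates of the pairs of a cellular 2-cycle with a fixed first
coordinate is a 1-cycle. -/
theorem IsCell2Cycle.isOneCycle_row {V : Type*} [Fintype V] {K : SimpleGraph V}
    {D : Finset (Sym2 V × Sym2 V)} (hD : IsCell2Cycle K D) (β : Sym2 V) :
    IsOneCycle K (Finset.univ.filter (fun e => (β, e) ∈ D)) := by
  refine ⟨fun e he => (hD.1 (β, e) (by simpa using he)).2, fun v => ?_⟩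
  convert (hD.2 v β).2 using 1
  refine Finset.card_bij (fun e _ => (β, e)) ?_ ?_ ?_
  · intro e he
    simpa using he
  · intro e _ e' _ h
    exact (Prod.ext_iff.1 h).2
  · rintro ⟨f, e⟩ h
    simp only [Finset.mem_filter] at h
    obtain ⟨h₁, rfl, h₂⟩ := h
    exact ⟨e, by simp [h₁, h₂], rfl⟩

/-- Künneth theorem for 2-cycles: if `C₁, …, C_q` is a base of the set of all
1-cycles of a finite graph `K` (every 1-cycle has a unique representation as a
sum of some of the `C_i`), then the products `C_i × C_j`, `i, j ∈ [q]`, form a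
base of the set of all cellular 2-cycles in `K²`: every cellular 2-cycle has a
unique representation as a sum of some of the `C_i × C_j`. (Sums are mod 2:
an element belongs to the sum iff it belongs to an odd number of summands.) -/
theorem stmt_19 {V : Type*} [Fintype V] (K : SimpleGraph V) (q : ℕ)
    (Cf : Fin q → Finset (Sym2 V))
    (hcyc : ∀ i, IsOneCycle K (Cf i))
    (hbase : ∀ C : Finset (Sym2 V), IsOneCycle K C →
      ∃! S : Finset (Fin q), ∀ e : Sym2 V,
        e ∈ C ↔ Odd ((S.filter (fun i => e ∈ Cf i)).card)) :
    ∀ D : Finset (Sym2 V × Sym2 V), IsCell2Cycle K D →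
      ∃! S : Finset (Fin q × Fin q), ∀ c : Sym2 V × Sym2 V,
        c ∈ D ↔ Odd ((S.filter (fun p => c.1 ∈ Cf p.1 ∧ c.2 ∈ Cf p.2)).card) := by
  intro D hD
  let B : Matrix (Sym2 V) (Fin q) (ZMod 2) := Matrix.of fun e i => if e ∈ Cf i then 1 else 0
  have hrep : ∀ (C : Finset (Sym2 V)) (S : Finset (Fin q)),
      (∀ e, e ∈ C ↔ Odd ((S.filter (fun i => e ∈ Cf i)).card)) ↔ charVec C = B *ᵥ charVec S := by
    intro C S
    simp only [mem_iff_odd_card_filter_iff, funext_iff]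
    rfl
  have hB : Function.Injective B.mulVec := by
    have hempty : IsOneCycle K ∅ := by simp [IsOneCycle]
    have hzero : charVec (∅ : Finset (Sym2 V)) = 0 := by ext; simp [charVec]
    have hzero' : charVec (∅ : Finset (Fin q)) = 0 := by ext; simp [charVec]
    refine (injective_iff_map_eq_zero B.mulVecLin).2 fun s hs => ?_
    obtain ⟨S, rfl⟩ := charVec_surjective s
    rw [Matrix.mulVecLin_apply] at hs
    rw [(hbase ∅ hempty).unique ((hrep ∅ S).2 (hzero.trans hs.symm))
      ((hrep ∅ ∅).2 (by rw [hzero, hzero', Matrix.mulVec_zero])), hzero']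
  have hrange : ∀ C, IsOneCycle K C → ∃ s, charVec C = B *ᵥ s := fun C hC =>
    let ⟨S, hS, _⟩ := hbase C hC
    ⟨charVec S, (hrep C S).1 hS⟩
  obtain ⟨M, hM, hMuniq⟩ := existsUnique_eq_mul_mul_transpose B hB
    (Matrix.of fun x y => charVec D (x, y))
    (fun y => by
      convert hrange _ (hD.isOneCycle_column y) using 3
      ext x; simp [charVec])
    (fun x => by
      convert hrange _ (hD.isOneCycle_row x) using 3
      ext y; simp [charVec])
  have hrep₂ : ∀ S : Finset (Fin q × Fin q),
      (∀ c : Sym2 V × Sym2 V,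
        c ∈ D ↔ Odd ((S.filter (fun p => c.1 ∈ Cf p.1 ∧ c.2 ∈ Cf p.2)).card)) ↔
      (Matrix.of fun x y => charVec D (x, y)) =
        B * (Matrix.of fun i j => charVec S (i, j)) * Bᵀ := by
    intro S
    simp only [mem_iff_odd_card_filter_iff, ← Matrix.ext_iff, Prod.forall, Matrix.of_apply]
    refine forall₂_congr fun x y => ?_
    simp only [Matrix.mul_apply, Fintype.sum_prod_type_right, Finset.sum_mul, B,
      Matrix.transpose_apply, Matrix.of_apply, ite_and]
    refine Eq.congr_right (Finset.sum_congr rfl fun j _ => Finset.sum_congr rfl fun i _ => ?_)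
    split_ifs <;> simp
  obtain ⟨S, hS⟩ := charVec_surjective (fun p : Fin q × Fin q => M p.1 p.2)
  refine ⟨S, (hrep₂ S).2 ?_, fun T hT => charVec_injective ?_⟩
  · rw [hS]
    exact hM
  · rw [hS, ← hMuniq _ ((hrep₂ T).1 hT)]
    rfl
end
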